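/- Let α be an irrational real number and let (a_k)_{k≥0} be the sequence of partial quotients of its regular continued fraction expansion (a_0 = ⌊α⌋ and, recursively, a_{k+1} = ⌊1/(α_k − a_k)⌋ where α_0 = α and α_{k+1} = 1/(α_k − a_k); equivalently, the sequence produced by Mathlib's continued fraction expansion of α, which is infinite since α is irrational). Then (a_k) is eventually periodic — i.e. there exist K ≥ 0 and l ≥ 1 with a_{k+l} = a_k for all k ≥ K — if and only if α is a quadratic irrational, i.e. there exist rational numbers A, B, C with A ≠ 0 and A·α² + B·α + C = 0. -/

import Mathlib

lemma cf_fract {x : ℝ} (hx : Irrational x) : 0 < x - (⌊x⌋ : ℝ) ∧ x - (⌊x⌋ : ℝ) < 1 := by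
  constructor
  · rcases lt_or_eq_of_le (Int.floor_le x) with h | h
    · linarith
    · exact absurd h (fun h => hx ⟨(⌊x⌋ : ℚ), by simpa using h⟩)
  · linarith [Int.lt_floor_add_one x]

lemma cf_irr {x : ℝ} (hx : Irrational x) (n : ℤ) : Irrational (1 / (x - (n : ℝ))) := by
  rw [one_div, irrational_inv_iff]
  exact hx.sub_intCast n

/-- Two sequences with the same partial quotients start at the same number. -/
lemma cf_unique (X Y : ℕ → ℝ) (hX : ∀ k, Irrational (X k)) (hY : ∀ k, Irrational (Y k))
    (hXs : ∀ k, X (k + 1) = 1 / (X k - (⌊X k⌋ : ℝ)))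
    (hYs : ∀ k, Y (k + 1) = 1 / (Y k - (⌊X k⌋ : ℝ)))
    (hfl : ∀ k, ⌊Y k⌋ = ⌊X k⌋) : X 0 = Y 0 := by
  have hd1 : ∀ k, |X k - Y k| < 1 := by
    intro k
    have h1 := cf_fract (hX k)
    have h2 := cf_fract (hY k)
    rw [hfl k] at h2
    rw [abs_lt]; constructor <;> linarith
  have hX1 : ∀ k, 1 < X (k + 1) := by
    intro k
    obtain ⟨h1, h2⟩ := cf_fract (hX k)
    rw [hXs, lt_div_iff₀ h1]; linarith
  have hY1 : ∀ k, 1 < Y (k + 1) := by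
    intro k
    obtain ⟨h1, h2⟩ := cf_fract (hY k)
    rw [hfl k] at h1 h2
    rw [hYs, lt_div_iff₀ h1]; linarith
  have hstep : ∀ k, |X (k + 1) - Y (k + 1)| = |X k - Y k| * (X (k + 1) * Y (k + 1)) := by
    intro k
    have h1 := (cf_fract (hX k)).1
    have h2 := (cf_fract (hY k)).1
    rw [hfl k] at h2
    have hp : 0 < X (k + 1) * Y (k + 1) :=
      mul_pos (by linarith [hX1 k]) (by linarith [hY1 k])
    rw [← abs_of_pos hp, ← abs_mul, abs_sub_comm]
    congr 1
    rw [hXs, hYs]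
    field_simp
    ring
  have h2X : ∀ (Z : ℕ → ℝ), (∀ k, Irrational (Z k)) →
      (∀ k, Z (k + 1) = 1 / (Z k - (⌊Z k⌋ : ℝ))) → (∀ k, 1 < Z (k + 1)) →
      ∀ k, 2 < Z (k + 1) * Z (k + 2) := by
    intro Z hZ hZs hZ1 k
    have h1 := (cf_fract (hZ (k + 1))).1
    have e : Z (k + 2) * (Z (k + 1) - (⌊Z (k + 1)⌋ : ℝ)) = 1 := by
      rw [hZs (k + 1)]; field_simp
    have hn : (1 : ℝ) ≤ (⌊Z (k + 1)⌋ : ℝ) := by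
      have : (1 : ℤ) ≤ ⌊Z (k + 1)⌋ := Int.le_floor.2 (by simpa using (hZ1 k).le)
      exact_mod_cast this
    have := hZ1 (k + 1)
    nlinarith
  have hXX := h2X X hX hXs hX1
  have hYY := h2X Y hY (by intro k; rw [hYs, hfl]) hY1
  have h2 : ∀ k, 4 * |X k - Y k| ≤ |X (k + 2) - Y (k + 2)| := by
    intro k
    rw [hstep (k + 1), hstep k]
    have : 4 ≤ (X (k + 1) * X (k + 2)) * (Y (k + 1) * Y (k + 2)) := by
      nlinarith [hXX k, hYY k]
    calc 4 * |X k - Y k| ≤ ((X (k + 1) * X (k + 2)) * (Y (k + 1) * Y (k + 2))) * |X k - Y k| :=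
          mul_le_mul_of_nonneg_right this (abs_nonneg _)
      _ = _ := by ring
  have h3 : ∀ m : ℕ, 4 ^ m * |X 0 - Y 0| ≤ |X (2 * m) - Y (2 * m)| := by
    intro m
    induction m with
    | zero => simp
    | succ m ih =>
      have := h2 (2 * m)
      rw [show 2 * (m + 1) = 2 * m + 2 by ring, pow_succ]
      linarith
  by_contra hne
  have hpos : 0 < |X 0 - Y 0| := abs_pos.2 (sub_ne_zero.2 hne)
  obtain ⟨m, hm⟩ := pow_unbounded_of_one_lt (1 / |X 0 - Y 0|) (by norm_num : (1 : ℝ) < 4)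
  rw [div_lt_iff₀ hpos] at hm
  linarith [h3 m, hd1 (2 * m)]

lemma cf_back {x : ℝ} (hx : Irrational x) (n : ℤ)
    (h : ∃ a b c : ℚ, a ≠ 0 ∧ (a : ℝ) * (1 / (x - n)) ^ 2 + (b : ℝ) * (1 / (x - n)) + (c : ℝ) = 0) :
    ∃ a b c : ℚ, a ≠ 0 ∧ (a : ℝ) * x ^ 2 + (b : ℝ) * x + (c : ℝ) = 0 := by
  obtain ⟨a, b, c, ha, h⟩ := h
  have hxn : x - n ≠ 0 := (hx.sub_intCast n).ne_zero
  have h' : (a : ℝ) + b * (x - n) + c * (x - n) ^ 2 = 0 := by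
    field_simp at h
    linarith
  refine ⟨c, b - 2 * n * c, a - b * n + c * n ^ 2, ?_, ?_⟩
  · rintro rfl
    have h2 : (a : ℝ) + b * (x - n) = 0 := by simpa using h'
    by_cases hb : b = 0
    · subst hb
      apply ha
      have : (a : ℝ) = 0 := by simpa using h2
      exact_mod_cast this
    · apply hx
      refine ⟨n - a / b, ?_⟩
      have hb' : (b : ℝ) ≠ 0 := by exact_mod_cast hb
      push_cast
      field_simp
      linarith
  · push_cast
    linarith

lemma cf_forward (A : ℕ → ℝ) (hI : ∀ k, Irrational (A k))
    (hAs : ∀ k, A (k + 1) = 1 / (A k - (⌊A k⌋ : ℝ))) (h1 : ∀ k, 1 < A (k + 1)) (k n : ℕ) :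
    ∃ p q r s : ℤ, 1 ≤ r ∧ 0 ≤ s ∧
      A k * (r * A (k + n + 1) + s) = p * A (k + n + 1) + q := by
  have key : ∀ k, A (k + 1) * (A k - (⌊A k⌋ : ℝ)) = 1 := by
    intro k
    have := (cf_fract (hI k)).1
    rw [hAs k]; field_simp
  induction n with
  | zero =>
    refine ⟨⌊A k⌋, 1, 1, 0, le_rfl, le_rfl, ?_⟩
    have := key k
    simp only [add_zero]
    push_cast
    linarith
  | succ n ih =>
    obtain ⟨p, q, r, s, hr, hs, h⟩ := ih
    have hn : (1 : ℤ) ≤ ⌊A (k + n + 1)⌋ := Int.le_floor.2 (by simpa using (h1 (k + n)).le)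
    refine ⟨p * ⌊A (k + n + 1)⌋ + q, p, r * ⌊A (k + n + 1)⌋ + s, r, by nlinarith, by linarith, ?_⟩
    have e := key (k + n + 1)
    rw [show k + (n + 1) + 1 = k + n + 1 + 1 by ring]
    push_cast
    generalize A (k + n + 1 + 1) = y at *
    generalize A (k + n + 1) = x at *
    linear_combination y * h + (p - A k * r) * e

/-- **Lagrange's theorem on periodic continued fractions, part (i).**
For an irrational real `α` with complete-quotient sequence `A 0 = α`,
`A (k+1) = 1/(A k - ⌊A k⌋)` (so the partial quotients are `a k = ⌊A k⌋`), the sequence of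
partial quotients is eventually periodic if and only if `α` is a quadratic irrational. -/
theorem stmt_19 (α : ℝ) (hirr : Irrational α)
    (A : ℕ → ℝ) (hA0 : A 0 = α)
    (hAs : ∀ k, A (k + 1) = 1 / (A k - (⌊A k⌋ : ℝ))) :
    (∃ (K l : ℕ), 1 ≤ l ∧ ∀ k, K ≤ k → ⌊A (k + l)⌋ = ⌊A k⌋) ↔
      (∃ a b c : ℚ, a ≠ 0 ∧ (a : ℝ) * α ^ 2 + (b : ℝ) * α + (c : ℝ) = 0) := by
  have hI : ∀ k, Irrational (A k) := by
    intro k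
    induction k with
    | zero => rwa [hA0]
    | succ k ih => rw [hAs]; exact cf_irr ih _
  have h1 : ∀ k, 1 < A (k + 1) := by
    intro k
    obtain ⟨h1, h2⟩ := cf_fract (hI k)
    rw [hAs, lt_div_iff₀ h1]; linarith
  constructor
  · rintro ⟨K, l, hl, hper⟩
    have hEq : A K = A (K + l) := by
      have := cf_unique (fun i => A (K + i)) (fun i => A (K + l + i)) (fun i => hI _)
        (fun i => hI _) (fun i => hAs (K + i)) ?_ ?_
      · simpa using this
      · intro i
        have e := hper (K + i) (by omega)
        have := hAs (K + l + i)
        rw [show K + i + l = K + l + i by ring] at e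
        rw [e] at this
        exact this
      · intro i
        have e := hper (K + i) (by omega)
        rw [show K + i + l = K + l + i by ring] at e
        exact e
    have hK : ∃ a b c : ℚ, a ≠ 0 ∧ (a : ℝ) * (A K) ^ 2 + (b : ℝ) * (A K) + (c : ℝ) = 0 := by
      obtain ⟨p, q, r, s, hr, hs, h⟩ := cf_forward A hI hAs h1 K (l - 1)
      rw [show K + (l - 1) + 1 = K + l by omega, ← hEq] at h
      refine ⟨r, s - p, -q, ?_, ?_⟩
      · have : r ≠ 0 := by omega
        exact_mod_cast this
      · push_cast
        linarith
    clear hEq hper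
    rw [← hA0]
    induction K with
    | zero => exact hK
    | succ K ih =>
      apply ih
      rw [hAs K] at hK
      exact cf_back (hI K) _ hK
  · rintro ⟨a', b', c', ha', h'⟩
    obtain ⟨a, b, c, ha, h⟩ : ∃ a b c : ℤ, a ≠ 0 ∧
        (a : ℝ) * α ^ 2 + (b : ℝ) * α + (c : ℝ) = 0 := by
      refine ⟨a'.num * b'.den * c'.den, b'.num * a'.den * c'.den, c'.num * a'.den * b'.den, ?_, ?_⟩
      · have := a'.den_nz
        have := b'.den_nz
        have := c'.den_nz
        have := Rat.num_ne_zero.2 ha'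
        positivity
      · have ea : (a' : ℝ) * a'.den = a'.num := by exact_mod_cast Rat.mul_den_eq_num a'
        have eb : (b' : ℝ) * b'.den = b'.num := by exact_mod_cast Rat.mul_den_eq_num b'
        have ec : (c' : ℝ) * c'.den = c'.num := by exact_mod_cast Rat.mul_den_eq_num c'
        push_cast
        rw [← ea, ← eb, ← ec]
        linear_combination (a'.den * b'.den * c'.den : ℝ) * h'
    have haR : (a : ℝ) ≠ 0 := by exact_mod_cast ha
    let Y : ℕ → ℝ := fun k => Nat.rec (-(b : ℝ) / a - α) (fun k y => 1 / (y - (⌊A k⌋ : ℝ))) k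
    have hY0 : Y 0 = -(b : ℝ) / a - α := rfl
    have hYs : ∀ k, Y (k + 1) = 1 / (Y k - (⌊A k⌋ : ℝ)) := fun k => rfl
    clear_value Y
    have hYI : ∀ k, Irrational (Y k) := by
      intro k
      induction k with
      | zero =>
        rw [hY0]
        have := hirr.ratCast_sub (-(b : ℚ) / a)
        simpa using this
      | succ k ih => rw [hYs]; exact cf_irr ih _
    have hinv : ∀ k, ∃ t : ℤ × ℤ × ℤ, t.1 ≠ 0 ∧ t.2.1 ^ 2 - 4 * t.1 * t.2.2 = b ^ 2 - 4 * a * c ∧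
        (t.1 : ℝ) * (A k + Y k) = - t.2.1 ∧ (t.1 : ℝ) * (A k * Y k) = t.2.2 := by
      intro k
      induction k with
      | zero =>
        refine ⟨(a, b, c), ha, rfl, ?_, ?_⟩
        · simp only [hY0, hA0]; field_simp; ring
        · simp only [hY0, hA0]; field_simp; linarith
      | succ k ih =>
        obtain ⟨⟨u, v, w⟩, hu, hD, hs, hp⟩ := ih
        simp only at hu hD hs hp
        have hx : A k - (⌊A k⌋ : ℝ) ≠ 0 := ((hI k).sub_intCast _).ne_zero
        have hy : Y k - (⌊A k⌋ : ℝ) ≠ 0 := ((hYI k).sub_intCast _).ne_zero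
        have huR : (u : ℝ) ≠ 0 := by exact_mod_cast hu
        have e1 := hAs k
        have e2 := hYs k
        generalize ⌊A k⌋ = n at *
        have e : ((u * n ^ 2 + v * n + w : ℤ) : ℝ) = u * ((A k - n) * (Y k - n)) := by
          push_cast
          linear_combination (-n : ℝ) * (-hs) - hp
        refine ⟨(u * n ^ 2 + v * n + w, 2 * u * n + v, u), ?_, ?_, ?_, ?_⟩
        · intro h0
          simp only at h0
          rw [h0] at e
          have : (u : ℝ) * ((A k - n) * (Y k - n)) ≠ 0 := by positivity
          exact this (by simpa using e.symm)
        · simp only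
          rw [← hD]; ring
        · simp only
          rw [e, e1, e2]
          push_cast
          field_simp
          linear_combination hs
        · simp only
          rw [e, e1, e2]
          field_simp
    choose t ht0 htD hts htp using hinv
    have hne : A 0 ≠ Y 0 := by
      intro h0
      rw [hA0, hY0] at h0
      apply hirr
      refine ⟨-(b : ℚ) / (2 * a), ?_⟩
      push_cast
      field_simp
      field_simp at h0
      linarith
    have hfloor : ∀ k, (1 : ℝ) ≤ (⌊A (k + 1)⌋ : ℝ) := by
      intro k
      have : (1 : ℤ) ≤ ⌊A (k + 1)⌋ := Int.le_floor.2 (by simpa using (h1 k).le)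
      exact_mod_cast this
    have hnegstep : ∀ k, Y k - (⌊A k⌋ : ℝ) < 0 → Y (k + 1) < 0 := by
      intro k hk
      rw [hYs]
      exact one_div_neg.2 hk
    obtain ⟨N, hN⟩ : ∃ N, Y (N + 1) < 0 := by
      obtain ⟨k, hk⟩ : ∃ k, ⌊Y k⌋ ≠ ⌊A k⌋ := by
        by_contra hall
        push Not at hall
        exact hne (cf_unique A Y hI hYI hAs hYs hall)
      rcases lt_trichotomy (Y k - (⌊A k⌋ : ℝ)) 0 with h0 | h0 | h0
      · exact ⟨k, hnegstep k h0⟩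
      · exact absurd h0 ((hYI k).sub_intCast _).ne_zero
      · have h2 : 1 ≤ Y k - (⌊A k⌋ : ℝ) := by
          by_contra hlt
          exact hk (Int.floor_eq_iff.2 ⟨by linarith, by linarith⟩)
        refine ⟨k + 1, hnegstep (k + 1) ?_⟩
        have h3 : Y (k + 1) ≤ 1 := by
          rw [hYs, div_le_one h0]; exact h2
        have h4 : Y (k + 1) ≠ 1 := (hYI (k + 1)).ne_one
        have h5 := lt_of_le_of_ne h3 h4
        linarith [hfloor k]
    have hNeg : ∀ i, Y (N + i + 1) < 0 := by
      intro i
      induction i with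
      | zero => exact hN
      | succ i ih => exact hnegstep (N + i + 1) (by linarith [hfloor (N + i)])
    set D := b ^ 2 - 4 * a * c with hDdef
    have hmem : ∀ i, t (N + i + 1) ∈ Set.Icc (-D) D ×ˢ (Set.Icc (-D) D ×ˢ Set.Icc (-D) D) := by
      intro i
      have e0 := ht0 (N + i + 1)
      have eD := htD (N + i + 1)
      have ep := htp (N + i + 1)
      have hx : 0 < A (N + i + 1) := by linarith [h1 (N + i)]
      have hy := hNeg i
      generalize t (N + i + 1) = T at *
      obtain ⟨u, v, w⟩ := T
      simp only at e0 eD ep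
      have huw : u * w < 0 := by
        have huR : (u : ℝ) ≠ 0 := by exact_mod_cast e0
        have : (u : ℝ) * w < 0 := by
          rw [← ep]
          have h6 : A (N + i + 1) * Y (N + i + 1) < 0 := mul_neg_of_pos_of_neg hx hy
          have h7 : 0 < (u : ℝ) ^ 2 := by positivity
          nlinarith
        exact_mod_cast this
      have hw0 : w ≠ 0 := by rintro rfl; simp at huw
      have hu1 : 1 ≤ |u| := Int.one_le_abs e0
      have hw1 : 1 ≤ |w| := Int.one_le_abs hw0
      have hab : |u| * |w| = -(u * w) := by rw [← abs_mul, abs_of_neg huw]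
      have hv : |v| ≤ v ^ 2 := by
        rw [← sq_abs]
        rcases eq_or_lt_of_le (abs_nonneg v) with h0 | h0
        · rw [← h0]; simp
        · nlinarith
      have hv2 := sq_nonneg v
      have b1 : |u| ≤ D := by nlinarith
      have b2 : |v| ≤ D := by nlinarith
      have b3 : |w| ≤ D := by nlinarith
      exact ⟨abs_le.1 b1, abs_le.1 b2, abs_le.1 b3⟩
    have hfin : (Set.Icc (-D) D ×ˢ (Set.Icc (-D) D ×ˢ Set.Icc (-D) D)).Finite :=
      (Set.finite_Icc _ _).prod ((Set.finite_Icc _ _).prod (Set.finite_Icc _ _))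
    obtain ⟨i, j, hij, hteq⟩ : ∃ i j : ℕ, i < j ∧ t (N + i + 1) = t (N + j + 1) := by
      obtain ⟨i, j, hij, h8⟩ := hfin.exists_lt_map_eq_of_forall_mem hmem
      exact ⟨i, j, hij, h8⟩
    have hAeq : A (N + i + 1) = A (N + j + 1) := by
      have s1 := hts (N + i + 1)
      have s2 := hts (N + j + 1)
      have p1 := htp (N + i + 1)
      have p2 := htp (N + j + 1)
      have e0 := ht0 (N + j + 1)
      rw [hteq] at s1 p1
      have huR : ((t (N + j + 1)).1 : ℝ) ≠ 0 := by exact_mod_cast e0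
      have s : A (N + i + 1) + Y (N + i + 1) = A (N + j + 1) + Y (N + j + 1) :=
        mul_left_cancel₀ huR (s1.trans s2.symm)
      have p : A (N + i + 1) * Y (N + i + 1) = A (N + j + 1) * Y (N + j + 1) :=
        mul_left_cancel₀ huR (p1.trans p2.symm)
      have hz : (A (N + i + 1) - A (N + j + 1)) * (A (N + i + 1) - Y (N + j + 1)) = 0 := by
        linear_combination A (N + i + 1) * s - p
      rcases mul_eq_zero.1 hz with h9 | h9
      · linarith
      · linarith [h1 (N + i), hNeg j]
    refine ⟨N + i + 1, j - i, by omega, ?_⟩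
    have hall : ∀ m, A (N + j + 1 + m) = A (N + i + 1 + m) := by
      intro m
      induction m with
      | zero => exact hAeq.symm
      | succ m ih => rw [← add_assoc, ← add_assoc, hAs, hAs (N + i + 1 + m), ih]
    intro k hk
    have := hall (k - (N + i + 1))
    rw [show N + j + 1 + (k - (N + i + 1)) = k + (j - i) by omega,
      show N + i + 1 + (k - (N + i + 1)) = k by omega] at this
    rw [this]
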